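/- Let n be odd, i an integer with gcd(i,n) = 1, and F : F_{2^n} → F_{2^n} the Gold function F(x) = x^{2^i+1}. Then for all a ∈ F_{2^n}: |W_F(a,1)| = 0 if Tr(a) = 0 and |W_F(a,1)| = 2^{(n+1)/2} if Tr(a) = 1; and for all b ∈ F_{2^n}: δ_F(1,b) = 0 if Tr(b) = 0 and δ_F(1,b) = 2 if Tr(b) = 1. -/

import Mathlib

open scoped Classical

/-- The sign `(−1)^{Tr(t)} ∈ ℤ`, with `Tr` the absolute trace of `F_{2^n}`. -/
noncomputable def sgn {n : ℕ} (t : GaloisField 2 n) : ℤ :=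
  (-1) ^ (Algebra.trace (ZMod 2) (GaloisField 2 n) t).val

/-- The weight enumerator `ν_S(a,b) = #{(u,v) ∈ S×S : u − v = (a,b)}`. -/
noncomputable def nu2 {n : ℕ} (S : Set (GaloisField 2 n × GaloisField 2 n))
    (g : GaloisField 2 n × GaloisField 2 n) : ℕ :=
  Nat.card {q : (GaloisField 2 n × GaloisField 2 n) × (GaloisField 2 n × GaloisField 2 n) //
    q.1 ∈ S ∧ q.2 ∈ S ∧ q.1 - q.2 = g}

/-- `S ⊆ F_{2^n} × F_{2^n}` is formally self dual under the trace pairing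
`⟨(x,y),(a,b)⟩ = (−1)^{Tr(ax+by)}`. -/
noncomputable def FSDTrace {n : ℕ} (S : Set (GaloisField 2 n × GaloisField 2 n)) : Prop :=
  ∀ a b : GaloisField 2 n,
    (∑ᶠ s ∈ S, sgn (a * s.1 + b * s.2)) ^ 2 = (Nat.card S : ℤ) * nu2 S (a, b)

/-- The graph `S_F = {(x, F(x)) : x ∈ F_{2^n}}`. -/
def graphSet {n : ℕ} (F : GaloisField 2 n → GaloisField 2 n) :
    Set (GaloisField 2 n × GaloisField 2 n) :=
  {q | ∃ x : GaloisField 2 n, q = (x, F x)}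

/-- `δ_F(a,b) = #{x : F(x+a) + F(x) = b}`. -/
noncomputable def deltaF {n : ℕ} (F : GaloisField 2 n → GaloisField 2 n)
    (a b : GaloisField 2 n) : ℕ :=
  Nat.card {x : GaloisField 2 n // F (x + a) + F x = b}

/-- The Walsh transform `W_F(a,b) = ∑_x (−1)^{Tr(bF(x)+ax)}`. -/
noncomputable def walsh {n : ℕ} (F : GaloisField 2 n → GaloisField 2 n)
    (a b : GaloisField 2 n) : ℤ :=
  ∑ᶠ x : GaloisField 2 n, sgn (b * F x + a * x)

/-- The sign is a character of the additive group. -/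
lemma sgn_add {n : ℕ} (x y : GaloisField 2 n) : sgn (x + y) = sgn x * sgn y := by
  simp only [sgn, map_add]
  generalize Algebra.trace (ZMod 2) (GaloisField 2 n) x = s
  generalize Algebra.trace (ZMod 2) (GaloisField 2 n) y = t
  revert s t
  decide

lemma sgn_eq_one {n : ℕ} {t : GaloisField 2 n}
    (ht : Algebra.trace (ZMod 2) (GaloisField 2 n) t = 0) : sgn t = 1 := by
  simp [sgn, ht]

lemma sgn_eq_neg_one {n : ℕ} {t : GaloisField 2 n}
    (ht : Algebra.trace (ZMod 2) (GaloisField 2 n) t = 1) : sgn t = -1 := by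
  simp [sgn, ht, ZMod.val_one]

/-- In odd degree the absolute trace of `1` is `1`. -/
lemma trace_one_of_odd {n : ℕ} (hn : Odd n) :
    Algebra.trace (ZMod 2) (GaloisField 2 n) 1 = 1 := by
  have h := Algebra.trace_algebraMap (R := ZMod 2) (S := GaloisField 2 n) 1
  rw [map_one, GaloisField.finrank 2 hn.pos.ne'] at h
  rw [h, nsmul_eq_mul, mul_one]
  exact ZMod.natCast_eq_one_iff_odd.2 hn

/-- The absolute trace is invariant under powers of the Frobenius. -/
lemma trace_pow_two_pow {n : ℕ} (k : ℕ) (x : GaloisField 2 n) :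
    Algebra.trace (ZMod 2) (GaloisField 2 n) (x ^ 2 ^ k) =
      Algebra.trace (ZMod 2) (GaloisField 2 n) x := by
  induction k with
  | zero => simp
  | succ k ih =>
    rw [pow_succ, pow_mul, ← ih]
    have h := Algebra.trace_eq_of_algEquiv
      (FiniteField.frobeniusAlgEquivOfAlgebraic (ZMod 2) (GaloisField 2 n)) (x ^ 2 ^ k)
    simpa using h

/-- An element of `F_{2^n}` fixed by `x ↦ x^{2^k}` with `k` prime to `n` lies in `F_2`. -/
lemma pow_two_pow_eq_self_iff {n k : ℕ} (hn : n ≠ 0) (hk : Nat.gcd k n = 1)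
    (x : GaloisField 2 n) : x ^ 2 ^ k = x ↔ x = 0 ∨ x = 1 := by
  constructor
  · intro h
    have hper (m : ℕ) : Function.IsPeriodicPt (fun y : GaloisField 2 n => y ^ 2) m x ↔
        x ^ 2 ^ m = x := by
      rw [Function.IsPeriodicPt, Function.IsFixedPt, pow_iterate]
    have hx : x ^ 2 ^ n = x := by
      let _ : Fintype (GaloisField 2 n) := Fintype.ofFinite _
      have := FiniteField.pow_card x
      rwa [← Nat.card_eq_fintype_card, GaloisField.card 2 n hn] at this
    have h1 := ((hper k).2 h).gcd ((hper n).2 hx)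
    rw [hk, hper] at h1
    have h2 : x * (x - 1) = 0 := by linear_combination h1
    simpa [sub_eq_zero] using h2
  · rintro (rfl | rfl) <;> simp

/-- Orthogonality for the trace characters in odd degree. -/
lemma sum_sgn_mul {n : ℕ} (hn : Odd n) [Fintype (GaloisField 2 n)] (c : GaloisField 2 n) :
    ∑ x : GaloisField 2 n, sgn (x * c) = if c = 0 then 2 ^ n else 0 := by
  split_ifs with hc
  · have h0 : sgn (0 : GaloisField 2 n) = 1 := sgn_eq_one (map_zero _)
    simp [hc, h0, ← Nat.card_eq_fintype_card, GaloisField.card 2 n hn.pos.ne']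
  · have h := Equiv.sum_comp (Equiv.addRight c⁻¹) (fun x : GaloisField 2 n => sgn (x * c))
    simp only [Equiv.coe_addRight, add_mul, inv_mul_cancel₀ hc, sgn_add,
      sgn_eq_neg_one (trace_one_of_odd hn), mul_neg, mul_one, Finset.sum_neg_distrib] at h
    linarith

/-- The derivative of a Gold function in direction `h`. -/
lemma gold_add {n : ℕ} (i : ℕ) (x h : GaloisField 2 n) :
    (x + h) ^ (2 ^ i + 1) + x ^ (2 ^ i + 1) =
      h ^ (2 ^ i + 1) + (x ^ 2 ^ i * h + x * h ^ 2 ^ i) := by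
  have h2 : (2 : GaloisField 2 n) = 0 := CharTwo.two_eq_zero
  rw [pow_succ, add_pow_char_pow]
  linear_combination (x ^ (2 ^ i + 1)) * h2

/-- The linear map `x ↦ x^{2^i} + x`. -/
noncomputable def frobeniusAddId (n i : ℕ) :
    GaloisField 2 n →ₗ[ZMod 2] GaloisField 2 n :=
  AddMonoidHom.toZModLinearMap 2
    { toFun := fun x => x ^ 2 ^ i + x
      map_zero' := by simp
      map_add' := fun x y => by rw [add_pow_char_pow]; ring }

@[simp]
lemma frobeniusAddId_apply (n i : ℕ) (x : GaloisField 2 n) :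
    frobeniusAddId n i x = x ^ 2 ^ i + x := rfl

lemma frobeniusAddId_eq_zero_iff {n i : ℕ} (hn : n ≠ 0) (hi : Nat.gcd i n = 1)
    (x : GaloisField 2 n) : frobeniusAddId n i x = 0 ↔ x = 0 ∨ x = 1 := by
  rw [frobeniusAddId_apply, CharTwo.add_eq_zero, pow_two_pow_eq_self_iff hn hi]

/-- Additive Hilbert 90 for a generator of the Galois group of `F_{2^n}`, `n` odd. -/
lemma range_frobeniusAddId {n i : ℕ} (hn : Odd n) (hi : Nat.gcd i n = 1) :
    LinearMap.range (frobeniusAddId n i) =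
      LinearMap.ker (Algebra.trace (ZMod 2) (GaloisField 2 n)) := by
  have hn0 := hn.pos.ne'
  apply Submodule.eq_of_le_of_finrank_le
  · rintro _ ⟨x, rfl⟩
    rw [LinearMap.mem_ker, frobeniusAddId_apply, map_add, trace_pow_two_pow,
      CharTwo.add_self_eq_zero]
  · have hker : Module.finrank (ZMod 2) (LinearMap.ker (frobeniusAddId n i)) ≤ 1 := by
      refine finrank_le_one ⟨1, (frobeniusAddId_eq_zero_iff hn0 hi 1).2 (Or.inr rfl)⟩ ?_
      rintro ⟨x, hx⟩
      rcases (frobeniusAddId_eq_zero_iff hn0 hi x).1 hx with rfl | rfl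
      · exact ⟨0, by ext; simp⟩
      · exact ⟨1, by ext; simp⟩
    have hrange : Module.finrank (ZMod 2)
        (LinearMap.range (Algebra.trace (ZMod 2) (GaloisField 2 n))) = 1 := by
      rw [LinearMap.range_eq_top.2 (Algebra.trace_surjective (ZMod 2) (GaloisField 2 n)),
        finrank_top, Module.finrank_self]
    have h1 := LinearMap.finrank_range_add_finrank_ker (frobeniusAddId n i)
    have h2 := LinearMap.finrank_range_add_finrank_ker
      (Algebra.trace (ZMod 2) (GaloisField 2 n))
    omega

lemma gold_add_one {n : ℕ} (i : ℕ) (x : GaloisField 2 n) :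
    (x + 1) ^ (2 ^ i + 1) + x ^ (2 ^ i + 1) = frobeniusAddId n i x + 1 := by
  rw [gold_add, frobeniusAddId_apply]
  ring

lemma deltaF_gold_one_of_trace_eq_zero {n : ℕ} (i : ℕ) (hn : Odd n) (hi : Nat.gcd i n = 1)
    {b : GaloisField 2 n} (hb : Algebra.trace (ZMod 2) (GaloisField 2 n) b = 0) :
    deltaF (fun x : GaloisField 2 n => x ^ (2 ^ i + 1)) 1 b = 0 := by
  rw [deltaF, Nat.card_eq_zero]
  left
  refine ⟨fun ⟨x, hx⟩ => ?_⟩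
  have h : frobeniusAddId n i x ∈ LinearMap.ker (Algebra.trace (ZMod 2) (GaloisField 2 n)) :=
    range_frobeniusAddId hn hi ▸ LinearMap.mem_range_self _ x
  rw [gold_add_one] at hx
  rw [← hx, map_add, LinearMap.mem_ker.1 h, trace_one_of_odd hn] at hb
  simp at hb

lemma deltaF_gold_one_of_trace_eq_one {n : ℕ} (i : ℕ) (hn : Odd n) (hi : Nat.gcd i n = 1)
    {b : GaloisField 2 n} (hb : Algebra.trace (ZMod 2) (GaloisField 2 n) b = 1) :
    deltaF (fun x : GaloisField 2 n => x ^ (2 ^ i + 1)) 1 b = 2 := by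
  have hmem : b + 1 ∈ LinearMap.range (frobeniusAddId n i) := by
    rw [range_frobeniusAddId hn hi, LinearMap.mem_ker, map_add, hb, trace_one_of_odd hn,
      CharTwo.add_self_eq_zero]
  obtain ⟨y, hy⟩ := hmem
  have hset : {x : GaloisField 2 n | (x + 1) ^ (2 ^ i + 1) + x ^ (2 ^ i + 1) = b} =
      {y, y + 1} := by
    ext x
    simp only [Set.mem_ofPred_eq, Set.mem_insert_iff, Set.mem_singleton_iff]
    rw [gold_add_one, ← CharTwo.sub_eq_add, sub_eq_iff_eq_add, ← hy, ← sub_eq_zero, ← map_sub,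
      frobeniusAddId_eq_zero_iff hn.pos.ne' hi, sub_eq_zero, sub_eq_iff_eq_add, add_comm 1 y]
  change Set.ncard {x : GaloisField 2 n | (x + 1) ^ (2 ^ i + 1) + x ^ (2 ^ i + 1) = b} = 2
  rw [hset, Set.ncard_pair (by simp)]

/-- The autocorrelation sums of a Gold function. -/
lemma sum_sgn_gold_bilinear {n : ℕ} (i : ℕ) (hn : Odd n) (hi : Nat.gcd i n = 1)
    [Fintype (GaloisField 2 n)] (h : GaloisField 2 n) :
    ∑ x : GaloisField 2 n, sgn (x ^ 2 ^ i * h + x * h ^ 2 ^ i) =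
      if h = 0 ∨ h = 1 then 2 ^ n else 0 := by
  have hterm (x : GaloisField 2 n) : sgn (x ^ 2 ^ i * h + x * h ^ 2 ^ i) =
      sgn (iterateFrobenius (GaloisField 2 n) 2 i x * (h ^ 2 ^ (2 * i) + h)) := by
    have ht := trace_pow_two_pow i (x * h ^ 2 ^ i)
    rw [mul_pow, ← pow_mul, ← pow_add, ← two_mul] at ht
    rw [sgn, sgn, iterateFrobenius_def, map_add, mul_add, map_add, ht, add_comm]
  have hgcd : Nat.gcd (2 * i) n = 1 :=
    Nat.Coprime.mul_left (Nat.coprime_two_left.2 hn) hi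
  have hbij : Function.Bijective (iterateFrobenius (GaloisField 2 n) 2 i) :=
    Finite.injective_iff_bijective.1 (RingHom.injective _)
  simp only [hterm]
  rw [hbij.sum_comp (fun y => sgn (y * (h ^ 2 ^ (2 * i) + h))), sum_sgn_mul hn,
    CharTwo.add_eq_zero]
  simp only [pow_two_pow_eq_self_iff hn.pos.ne' hgcd]

lemma walsh_gold_sq {n : ℕ} (i : ℕ) (hn : Odd n) (hi : Nat.gcd i n = 1)
    (a : GaloisField 2 n) :
    walsh (fun x : GaloisField 2 n => x ^ (2 ^ i + 1)) a 1 ^ 2 = 2 ^ n * (1 - sgn a) := by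
  let _ : Fintype (GaloisField 2 n) := Fintype.ofFinite _
  have hterm (x h : GaloisField 2 n) :
      sgn (x ^ (2 ^ i + 1) + a * x) * sgn ((x + h) ^ (2 ^ i + 1) + a * (x + h)) =
        sgn (h ^ (2 ^ i + 1) + a * h) * sgn (x ^ 2 ^ i * h + x * h ^ 2 ^ i) := by
    rw [← sgn_add, ← sgn_add]
    congr 1
    have h2 : (2 : GaloisField 2 n) = 0 := CharTwo.two_eq_zero
    linear_combination gold_add i x h + a * x * h2
  have h0 : sgn (0 : GaloisField 2 n) = 1 := sgn_eq_one (map_zero _)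
  rw [walsh, finsum_eq_sum_of_fintype, sq, Finset.sum_mul_sum]
  simp only [one_mul]
  calc ∑ x : GaloisField 2 n, ∑ y : GaloisField 2 n,
        sgn (x ^ (2 ^ i + 1) + a * x) * sgn (y ^ (2 ^ i + 1) + a * y)
      = ∑ x : GaloisField 2 n, ∑ h : GaloisField 2 n,
        sgn (h ^ (2 ^ i + 1) + a * h) * sgn (x ^ 2 ^ i * h + x * h ^ 2 ^ i) := by
        refine Finset.sum_congr rfl fun x _ => ?_
        simp only [← hterm]
        exact (Equiv.sum_comp (Equiv.addLeft x) (fun y =>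
          sgn (x ^ (2 ^ i + 1) + a * x) * sgn (y ^ (2 ^ i + 1) + a * y))).symm
    _ = ∑ h : GaloisField 2 n, sgn (h ^ (2 ^ i + 1) + a * h) *
          (if h = 0 ∨ h = 1 then 2 ^ n else 0) := by
        rw [Finset.sum_comm]
        simp only [← Finset.mul_sum, sum_sgn_gold_bilinear i hn hi]
    _ = ∑ h ∈ ({0, 1} : Finset (GaloisField 2 n)), sgn (h ^ (2 ^ i + 1) + a * h) * 2 ^ n := by
        rw [← Finset.sum_subset (Finset.subset_univ ({0, 1} : Finset (GaloisField 2 n)))]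
        · refine Finset.sum_congr rfl fun h hh => ?_
          rw [if_pos (by simpa using hh)]
        · intro h _ hh
          rw [if_neg (by simpa using hh), mul_zero]
    _ = 2 ^ n * (1 - sgn a) := by
        rw [Finset.sum_pair zero_ne_one]
        simp only [one_pow, mul_one, mul_zero, add_zero, sgn_add,
          sgn_eq_neg_one (trace_one_of_odd hn), zero_pow (Nat.succ_ne_zero _), h0]
        ring

theorem stmt12 (n i : ℕ) (hn : Odd n) (hi : Nat.gcd i n = 1) :
    let F : GaloisField 2 n → GaloisField 2 n := fun x => x ^ (2 ^ i + 1)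
    (∀ a : GaloisField 2 n,
      (Algebra.trace (ZMod 2) (GaloisField 2 n) a = 0 → |walsh F a 1| = 0) ∧
      (Algebra.trace (ZMod 2) (GaloisField 2 n) a = 1 →
        |walsh F a 1| = 2 ^ ((n + 1) / 2))) ∧
    (∀ b : GaloisField 2 n,
      (Algebra.trace (ZMod 2) (GaloisField 2 n) b = 0 → deltaF F 1 b = 0) ∧
      (Algebra.trace (ZMod 2) (GaloisField 2 n) b = 1 → deltaF F 1 b = 2)) := by
  intro F
  refine ⟨fun a => ⟨fun ha => ?_, fun ha => ?_⟩, fun b =>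
    ⟨deltaF_gold_one_of_trace_eq_zero i hn hi, deltaF_gold_one_of_trace_eq_one i hn hi⟩⟩
  · have h := walsh_gold_sq i hn hi a
    rw [sgn_eq_one ha, sub_self, mul_zero] at h
    rw [abs_eq_zero]
    exact pow_eq_zero_iff two_ne_zero |>.1 h
  · have h := walsh_gold_sq i hn hi a
    have hexp : (n + 1) / 2 * 2 = n + 1 := by
      obtain ⟨m, rfl⟩ := hn
      omega
    have hsq : walsh F a 1 ^ 2 = (2 ^ ((n + 1) / 2)) ^ 2 := by
      rw [← pow_mul, hexp, h, sgn_eq_neg_one ha, pow_succ]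
      norm_num
    rw [sq_eq_sq_iff_abs_eq_abs] at hsq
    rw [hsq, abs_of_pos (by positivity)]
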